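/- There is no finite group of order 3456 (= 54·64 = 2⁷·3³) that has an irreducible complex character of degree 54. -/

import Mathlib

open CategoryTheory

/-- `χ : G → ℂ` is the character of an irreducible (simple) finite-dimensional complex
representation of the group `G`. -/
def IsIrrChar (G : Type) [Group G] (χ : G → ℂ) : Prop :=
  ∃ V : FDRep ℂ G, Simple V ∧ FDRep.character V = χ

theorem LinearMap.trace_mulLeft_pi_matrix {n : ℕ} (d : Fin n → ℕ)
    (x : Π i, Matrix (Fin (d i)) (Fin (d i)) ℂ) :
    LinearMap.trace ℂ _ (LinearMap.mulLeft ℂ x) = ∑ i, (d i : ℂ) * (x i).trace := by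
  classical
  rw [LinearMap.trace_eq_matrix_trace ℂ
    (Pi.basis fun i => Matrix.stdBasis ℂ (Fin (d i)) (Fin (d i)))]
  rw [Matrix.trace, Fintype.sum_sigma]
  refine Finset.sum_congr rfl fun i _ => ?_
  rw [Fintype.sum_prod_type]
  have key : ∀ a b : Fin (d i), Matrix.diag ((LinearMap.toMatrix
      (Pi.basis fun i => Matrix.stdBasis ℂ (Fin (d i)) (Fin (d i)))
      (Pi.basis fun i => Matrix.stdBasis ℂ (Fin (d i)) (Fin (d i))))
      (LinearMap.mulLeft ℂ x)) ⟨i, (a, b)⟩ = x i a a := by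
    intro a b
    rw [Matrix.diag_apply, LinearMap.toMatrix_apply]
    simp [Pi.basis_repr, Matrix.stdBasis, Matrix.mul_apply, Pi.single_apply, ite_apply]
  simp only [key, Matrix.trace, Finset.mul_sum, Matrix.diag_apply]
  simp

theorem MonoidAlgebra.trace_mulLeft_of {H : Type*} [Group H] [Fintype H] [DecidableEq H] (h : H) :
    LinearMap.trace ℂ _ (LinearMap.mulLeft ℂ (MonoidAlgebra.of ℂ H h)) =
      if h = 1 then (Fintype.card H : ℂ) else 0 := by
  rw [LinearMap.trace_eq_matrix_trace ℂ (MonoidAlgebra.basis H ℂ), Matrix.trace]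
  have key : ∀ a : H, Matrix.diag ((LinearMap.toMatrix (MonoidAlgebra.basis H ℂ)
      (MonoidAlgebra.basis H ℂ)) (LinearMap.mulLeft ℂ (MonoidAlgebra.of ℂ H h))) a =
      if h = 1 then 1 else 0 := by
    intro a
    rw [Matrix.diag_apply, LinearMap.toMatrix_apply]
    simp [MonoidAlgebra.basis, Finsupp.single_apply]
  simp only [key]
  simp

theorem Matrix.trace_involution {d : ℕ} (Z : Matrix (Fin d) (Fin d) ℂ) (hZ : Z * Z = 1) :
    ∃ r : ℕ, r ≤ d ∧ Z.trace = 2 * (r : ℂ) - d ∧ (r = 0 → Z = -1) ∧ (r = d → Z = 1) := by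
  have idem : ∀ E : Matrix (Fin d) (Fin d) ℂ, IsIdempotentElem E →
      ∃ r : ℕ, E.trace = r ∧ (r = 0 → E = 0) := by
    intro E hE
    have hE' : IsIdempotentElem (Matrix.toLin' E) := by
      rw [IsIdempotentElem, Module.End.mul_eq_comp, ← Matrix.toLin'_mul, hE.eq]
    have htr : E.trace = _ := (Matrix.trace_toLin'_eq E).symm.trans
      (LinearMap.IsIdempotentElem.isProj_range _ hE').trace
    refine ⟨_, htr, fun h0 => ?_⟩
    rw [h0, Nat.cast_zero, ← Matrix.trace_toLin'_eq] at htr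
    simpa using LinearMap.IsIdempotentElem.eq_zero_of_trace_eq_zero hE' htr
  have hE : IsIdempotentElem ((1 / 2 : ℂ) • (1 + Z)) := by
    rw [IsIdempotentElem, smul_mul_smul_comm, add_mul, mul_add, mul_add, hZ]
    simp only [mul_one, one_mul]
    module
  obtain ⟨r, hr, hr0⟩ := idem _ hE
  obtain ⟨s, hs, hs0⟩ := idem _ hE.one_sub
  have hsum : (r : ℂ) + s = d := by
    rw [← hr, ← hs, ← Matrix.trace_add]; simp
  have hsum' : r + s = d := by exact_mod_cast hsum
  refine ⟨r, by omega, ?_, fun h => ?_, fun h => ?_⟩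
  · rw [← hr]; simp; ring
  · have := hr0 h
    rw [smul_eq_zero_iff_right (by norm_num)] at this
    exact (neg_eq_of_add_eq_zero_right this).symm
  · have := hs0 (by omega)
    have h2 : Z = 1 - (2 : ℂ) • (1 - (1 / 2 : ℂ) • (1 + Z)) := by module
    rw [h2, this]; simp

theorem Matrix.eq_smul_one_of_forall_commute {d : ℕ} (M : Matrix (Fin d) (Fin d) ℂ)
    (h : ∀ N, N * M = M * N) : ∃ c : ℂ, M = c • 1 := by
  have : M ∈ Subalgebra.center ℂ (Matrix (Fin d) (Fin d) ℂ) := by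
    rw [Subalgebra.mem_center_iff]; exact h
  rw [Matrix.subalgebraCenter_eq_scalarAlgHom_map] at this
  obtain ⟨c, -, hc⟩ := this
  refine ⟨c, ?_⟩
  rw [← hc]
  ext i j
  simp [Matrix.scalar_apply, Matrix.diagonal_apply, Matrix.one_apply]

/-- For a finite group with an involution whose conjugacy class has size a power of three,
there is a proper normal subgroup modulo which the involution is central. -/
theorem exists_normal_of_involution_of_card_class {H : Type*} [Group H] [Finite H] (z : H)
    (hz1 : z ≠ 1) (hz : z * z = 1) (k : ℕ) (hk : (MulAction.orbit (ConjAct H) z).ncard = 3 ^ k) :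
    ∃ N : Subgroup H, N.Normal ∧ N ≠ ⊤ ∧ ∀ h, z * h * z⁻¹ * h⁻¹ ∈ N := by
  classical
  by_contra! hcon
  have := Fintype.ofFinite H
  obtain ⟨n, d, hd, ⟨e⟩⟩ :=
    IsSemisimpleRing.exists_algEquiv_pi_matrix_of_isAlgClosed ℂ (MonoidAlgebra ℂ H)
  let r : ∀ i, MonoidAlgebra ℂ H →ₐ[ℂ] Matrix (Fin (d i)) (Fin (d i)) ℂ :=
    fun i => (Pi.evalAlgHom ℂ _ i).comp e.toAlgHom
  let ρ : ∀ i, H →* Matrix (Fin (d i)) (Fin (d i)) ℂ :=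
    fun i => ((r i : MonoidAlgebra ℂ H →* _)).comp (MonoidAlgebra.of ℂ H)
  have hr : ∀ i, Function.Surjective (r i) := fun i =>
    (Function.surjective_eval i).comp e.surjective
  have htr : ∀ x : MonoidAlgebra ℂ H,
      LinearMap.trace ℂ _ (LinearMap.mulLeft ℂ x) = ∑ i, (d i : ℂ) * (r i x).trace := by
    intro x
    rw [← LinearMap.trace_conj' _ e.toLinearEquiv, ← LinearMap.trace_mulLeft_pi_matrix]
    congr 1
    refine LinearMap.ext fun y => ?_
    change e (x * e.symm y) = e x * y
    rw [map_mul, e.apply_symm_apply]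
  have hcomm : ∀ i (M : Matrix (Fin (d i)) (Fin (d i)) ℂ), (∀ h, ρ i h * M = M * ρ i h) →
      ∃ c : ℂ, M = c • 1 := by
    intro i M hM
    refine Matrix.eq_smul_one_of_forall_commute M fun N => ?_
    obtain ⟨x, rfl⟩ := hr i N
    induction x using MonoidAlgebra.induction_on with
    | of h => exact hM h
    | add x y hx hy => rw [map_add, add_mul, mul_add, hx, hy]
    | smul c x hx => rw [map_smul, smul_mul_assoc, mul_smul_comm, hx]
  -- the regular character vanishes at the involution
  have hreg : ∑ i, (d i : ℂ) * (ρ i z).trace = 0 := by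
    have := htr (MonoidAlgebra.of ℂ H z)
    rw [MonoidAlgebra.trace_mulLeft_of, if_neg hz1] at this
    exact this.symm
  -- exactly one of the factors is trivial
  have htriv : ∑ i, (d i : ℂ) * (∑ h, ρ i h).trace = Fintype.card H := by
    have h1 := htr (∑ h, MonoidAlgebra.of ℂ H h)
    have h2 : LinearMap.mulLeft ℂ (∑ h, MonoidAlgebra.of ℂ H h) =
      ∑ h, LinearMap.mulLeft ℂ (MonoidAlgebra.of ℂ H h) := by
      ext1 y
      refine LinearMap.ext fun w => ?_
      simp [Finset.sum_mul]
    rw [h2, map_sum] at h1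
    simp only [MonoidAlgebra.trace_mulLeft_of, map_sum] at h1
    rw [Finset.sum_ite_eq' Finset.univ (1 : H), if_pos (Finset.mem_univ _)] at h1
    simp only [Matrix.trace_sum] at h1 ⊢
    exact h1.symm
  have hnontriv : ∀ i, ¬ (∀ h, ρ i h = 1) → ∑ h, ρ i h = 0 := by
    intro i hi
    push Not at hi
    obtain ⟨g, hg⟩ := hi
    have hl : ∀ g, ρ i g * ∑ h, ρ i h = ∑ h, ρ i h := by
      intro g
      rw [Finset.mul_sum]
      simp only [← map_mul]
      exact Equiv.sum_comp (Equiv.mulLeft g) (fun h => ρ i h)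
    have hr' : ∀ g, (∑ h, ρ i h) * ρ i g = ∑ h, ρ i h := by
      intro g
      rw [Finset.sum_mul]
      simp only [← map_mul]
      exact Equiv.sum_comp (Equiv.mulRight g) (fun h => ρ i h)
    obtain ⟨c, hc⟩ := hcomm i _ fun h => (hl h).trans (hr' h).symm
    have := hl g
    rw [hc, mul_smul_comm, mul_one, ← sub_eq_zero, ← smul_sub, smul_eq_zero] at this
    rw [hc, this.resolve_right (sub_ne_zero.mpr hg), zero_smul]
  have hone : ∑ i with (∀ h, ρ i h = 1), (d i : ℤ) * d i = 1 := by
    have h0 : (Fintype.card H : ℂ) ≠ 0 := Nat.cast_ne_zero.mpr Fintype.card_ne_zero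
    have : ((∑ i with (∀ h, ρ i h = 1), (d i : ℤ) * d i : ℤ) : ℂ) = 1 := by
      refine mul_left_cancel₀ h0 ?_
      rw [mul_one]
      conv_rhs => rw [← htriv]
      rw [← Finset.sum_filter_add_sum_filter_not Finset.univ (fun i => ∀ h, ρ i h = 1),
        Finset.sum_eq_zero (s := Finset.univ.filter fun i => ¬ ∀ h, ρ i h = 1) fun i hi => by
          rw [hnontriv i (by simpa using hi), Matrix.trace_zero, mul_zero], add_zero]
      push_cast
      rw [Finset.mul_sum]
      refine Finset.sum_congr rfl fun i hi => ?_
      simp only [Finset.mem_filter, Finset.mem_univ, true_and] at hi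
      simp only [hi, Finset.sum_const, Finset.card_univ, Matrix.trace_smul, Matrix.trace_one,
        Fintype.card_fin]
      simp only [nsmul_eq_mul]
      ring
    exact_mod_cast this
  have hdvd : ∀ i, ¬ (∀ h, ρ i h = 1) → ∃ m : ℤ, (ρ i z).trace = m ∧ (3 : ℤ) ∣ d i * m := by
    intro i hi
    have hdi : d i ≠ 0 := (hd i).out
    have hZ : ρ i z * ρ i z = 1 := by rw [← map_mul, hz, map_one]
    obtain ⟨s, hsd, hs, hs0, hs1⟩ := Matrix.trace_involution (ρ i z) hZ
    refine ⟨2 * s - d i, by rw [hs]; push_cast; ring, ?_⟩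
    by_cases h3 : (3 : ℤ) ∣ d i
    · exact h3.mul_right _
    have hns : ∀ c : ℂ, ρ i z ≠ c • 1 := by
      intro c hc
      have hne : (ρ i).ker ≠ ⊤ := by
        intro htop
        exact hi fun h => (ρ i).mem_ker.mp (htop ▸ Subgroup.mem_top h)
      obtain ⟨h, hh⟩ := hcon (ρ i).ker (MonoidHom.normal_ker _) hne
      refine hh ((ρ i).mem_ker.mpr ?_)
      have hcm : ρ i (z * h) = ρ i (h * z) := by
        rw [map_mul, map_mul, hc, smul_mul_assoc, mul_smul_comm, one_mul, mul_one]
      rw [mul_assoc, map_mul, hcm, ← map_mul]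
      simp
    have hs0' : s ≠ 0 := fun h => hns (-1) (by rw [hs0 h]; simp)
    have hs1' : s ≠ d i := fun h => hns 1 (by rw [hs1 h]; simp)
    set C : Finset H := (MulAction.orbit (ConjAct H) z).toFinset with hC
    have hCcard : C.card = 3 ^ k := by rw [← hk, Set.ncard_eq_toFinset_card']
    have hCmem : ∀ x, x ∈ C ↔ IsConj x z := fun x => by
      rw [hC, Set.mem_toFinset, ConjAct.mem_orbit_conjAct]
    obtain ⟨c, hc⟩ := hcomm i (∑ x ∈ C, ρ i x) fun h => by
      rw [Finset.mul_sum, Finset.sum_mul]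
      refine Finset.sum_equiv (MulAut.conj h).toEquiv (fun x => ?_) fun x _ => ?_
      · rw [hCmem, hCmem]
        have hx : IsConj x (h * x * h⁻¹) := isConj_iff.mpr ⟨h, rfl⟩
        exact ⟨fun hxz => hx.symm.trans hxz, fun hxz => hx.trans hxz⟩
      · rw [← map_mul, ← map_mul]
        simp
    have hctr : (3 ^ k : ℂ) * (2 * s - d i) = c * d i := by
      have h1 := congrArg Matrix.trace hc
      rw [Matrix.trace_sum, Finset.sum_congr rfl (g := fun _ => (ρ i z).trace) fun x hx => ?_] at h1
      · rw [Finset.sum_const, hCcard, hs] at h1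
        simpa using h1
      · obtain ⟨g, hg⟩ := isConj_iff.mp ((hCmem x).mp hx)
        rw [← hg, map_mul, Matrix.trace_mul_comm, ← map_mul]
        simp
    have hci : IsIntegral ℤ c := by
      have h1 : IsIntegral ℤ (∑ x ∈ C, MonoidAlgebra.of ℤ H x) := Algebra.IsIntegral.isIntegral _
      have h2 := h1.map (MonoidAlgebra.lift ℤ _ H (ρ i))
      rw [map_sum] at h2
      simp only [MonoidAlgebra.lift_of] at h2
      rw [hc, ← Algebra.algebraMap_eq_smul_one] at h2
      have : Nonempty (Fin (d i)) := ⟨⟨0, Nat.pos_of_ne_zero hdi⟩⟩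
      exact (isIntegral_algebraMap_iff (algebraMap ℂ (Matrix (Fin (d i)) (Fin (d i)) ℂ)).injective).mp h2
    have hdC : (d i : ℂ) ≠ 0 := Nat.cast_ne_zero.mpr hdi
    have hcq : c = algebraMap ℚ ℂ (3 ^ k * (2 * s - d i) / d i) := by
      simp only [eq_ratCast]
      push_cast
      rw [hctr, mul_div_cancel_right₀ _ hdC]
    rw [hcq, isIntegral_algebraMap_iff (algebraMap ℚ ℂ).injective] at hci
    obtain ⟨y, hy⟩ := IsIntegrallyClosed.isIntegral_iff.mp hci
    have hdQ : (d i : ℚ) ≠ 0 := Nat.cast_ne_zero.mpr hdi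
    have hyZ : (3 ^ k * (2 * s - d i) : ℤ) = d i * y := by
      rw [eq_div_iff hdQ, eq_intCast] at hy
      have : ((3 ^ k * (2 * s - d i) : ℤ) : ℚ) = ((d i * y : ℤ) : ℚ) := by
        push_cast
        rw [← hy, mul_comm]
      exact_mod_cast this
    have hcop : IsCoprime (d i : ℤ) (3 ^ k) :=
      (((Int.prime_three.coprime_iff_not_dvd).mpr h3).symm).pow_right
    have hdm : (d i : ℤ) ∣ 2 * s - d i := hcop.dvd_of_dvd_mul_left ⟨y, hyZ⟩
    have hlt : |(2 * s - d i : ℤ)| < d i := by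
      rw [abs_lt]
      omega
    rw [Int.eq_zero_of_abs_lt_dvd hdm hlt, mul_zero]
    exact dvd_zero _
  choose! m hm hm3 using hdvd
  have hsum : ∑ i with (∀ h, ρ i h = 1), (d i : ℤ) * d i +
      ∑ i with ¬ (∀ h, ρ i h = 1), (d i : ℤ) * m i = 0 := by
    have : ((∑ i with (∀ h, ρ i h = 1), (d i : ℤ) * d i +
      ∑ i with ¬ (∀ h, ρ i h = 1), (d i : ℤ) * m i : ℤ) : ℂ) = 0 := by
      rw [← hreg, ← Finset.sum_filter_add_sum_filter_not Finset.univ (fun i => ∀ h, ρ i h = 1)]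
      push_cast
      congr 1 <;> refine Finset.sum_congr rfl fun i hi => ?_ <;>
        simp only [Finset.mem_filter, Finset.mem_univ, true_and] at hi
      · simp [hi z]
      · rw [hm i hi]
    exact_mod_cast this
  have h3 : (3 : ℤ) ∣ ∑ i with ¬ (∀ h, ρ i h = 1), (d i : ℤ) * m i :=
    Finset.dvd_sum fun i hi => hm3 i (by simpa using hi)
  rw [hone] at hsum
  omega

theorem IsSimpleGroup.isSolvable_of_card_dvd {H : Type*} [Group H] [Finite H] [IsSimpleGroup H]
    (a b : ℕ) (h : Nat.card H ∣ 2 ^ a * 3 ^ b) : Group.IsSolvable H := by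
  by_cases h2 : 2 ∣ Nat.card H
  · have : Fact (Nat.Prime 2) := ⟨Nat.prime_two⟩
    obtain ⟨P⟩ : Nonempty (Sylow 2 H) := inferInstance
    have hPn : Nontrivial P := by
      rw [← Finite.one_lt_card_iff_nontrivial]
      have := P.dvd_card_of_dvd_card h2
      have hpos : 0 < Nat.card P := Nat.card_pos
      exact lt_of_lt_of_le one_lt_two (Nat.le_of_dvd hpos this)
    have hZn : Nontrivial (Subgroup.center P) := P.isPGroup'.center_nontrivial
    have hZ2 : 2 ∣ Nat.card (Subgroup.center P) := by
      obtain ⟨n, hn⟩ := (P.isPGroup'.to_subgroup (Subgroup.center P)).exists_card_eq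
      have h1 : 1 < Nat.card (Subgroup.center P) := Finite.one_lt_card
      rw [hn] at h1 ⊢
      exact dvd_pow_self 2 (by rintro rfl; simp at h1)
    obtain ⟨y, hy⟩ := exists_prime_orderOf_dvd_card' 2 hZ2
    set z : H := ((y : P) : H) with hzdef
    have hyz : orderOf z = 2 := by
      rw [hzdef, Subgroup.orderOf_coe, Subgroup.orderOf_coe, hy]
    have hz1 : z ≠ 1 := by
      intro h1; rw [h1, orderOf_one] at hyz; omega
    have hzz : z * z = 1 := by rw [← pow_two, ← hyz, pow_orderOf_eq_one]
    have hle : (P : Subgroup H) ≤ Subgroup.centralizer {z} := by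
      intro x hx
      rw [Subgroup.mem_centralizer_singleton_iff]
      have := Subgroup.mem_center_iff.mp y.2 ⟨x, hx⟩
      exact congrArg Subtype.val this
    have hidx : (MulAction.orbit (ConjAct H) z).ncard = (Subgroup.centralizer {z}).index := by
      have h1 := MulAction.index_stabilizer (ConjAct H) z
      rw [← h1, Subgroup.centralizer_eq_comap_stabilizer]
      exact (Subgroup.index_comap_of_surjective _ ConjAct.toConjAct.surjective).symm
    have hdvd : (Subgroup.centralizer {z}).index ∣ 3 ^ b := by
      have h1 : (Subgroup.centralizer {z}).index ∣ 2 ^ a * 3 ^ b :=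
        (Subgroup.index_dvd_card _).trans h
      have h3 : ¬ 2 ∣ (Subgroup.centralizer {z}).index := fun h4 =>
        P.not_dvd_index (h4.trans (Subgroup.index_dvd_of_le hle))
      exact (((Nat.prime_two.coprime_iff_not_dvd).mpr h3).symm.pow_right a).dvd_of_dvd_mul_left h1
    obtain ⟨k, -, hk⟩ := (Nat.dvd_prime_pow Nat.prime_three).mp hdvd
    obtain ⟨N, hN, hNtop, hNz⟩ := exists_normal_of_involution_of_card_class z hz1 hzz k (hidx.trans hk)
    have hNbot : N = ⊥ := (hN.eq_bot_or_eq_top).resolve_right hNtop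
    have hzc : z ∈ Subgroup.center H := by
      rw [Subgroup.mem_center_iff]
      intro g
      have := hNz g
      rw [hNbot, Subgroup.mem_bot, mul_inv_eq_one, mul_inv_eq_iff_eq_mul] at this
      exact this.symm
    have hctop : Subgroup.center H = ⊤ := by
      refine (Subgroup.Normal.eq_bot_or_eq_top inferInstance).resolve_left fun hbot => hz1 ?_
      rwa [hbot, Subgroup.mem_bot] at hzc
    refine Group.isSolvable_of_comm fun x y => ?_
    have : y ∈ Subgroup.center H := hctop ▸ Subgroup.mem_top y
    exact Subgroup.mem_center_iff.mp this x
  · have h3 : Nat.card H ∣ 3 ^ b :=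
      (((Nat.prime_two.coprime_iff_not_dvd).mpr h2).symm.pow_right a).dvd_of_dvd_mul_left h
    have : Fact (Nat.Prime 3) := ⟨Nat.prime_three⟩
    obtain ⟨k, -, hk⟩ := (Nat.dvd_prime_pow Nat.prime_three).mp h3
    have := (IsPGroup.of_card hk).isNilpotent
    infer_instance

/-- Burnside's theorem for the primes two and three. -/
theorem Group.isSolvable_of_card_dvd (a b n : ℕ) : ∀ (H : Type) [Group H] [Finite H],
    Nat.card H = n → Nat.card H ∣ 2 ^ a * 3 ^ b → Group.IsSolvable H := by
  induction n using Nat.strong_induction_on with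
  | _ n ih =>
    intro H _ _ hn h
    by_cases hH : Nontrivial H
    · by_cases hs : IsSimpleGroup H
      · exact IsSimpleGroup.isSolvable_of_card_dvd a b h
      · have : ∃ N : Subgroup H, N.Normal ∧ N ≠ ⊥ ∧ N ≠ ⊤ := by
          by_contra! hcon
          exact hs ⟨fun N hN => or_iff_not_imp_left.mpr (hcon N hN)⟩
        obtain ⟨N, hN, hb, ht⟩ := this
        have h1 := N.card_mul_index
        have hpos : 0 < Nat.card H := Nat.card_pos
        have hN1 : 1 < Nat.card N := N.one_lt_card_iff_ne_bot.mpr hb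
        have hN2 : N.index ≠ 1 := fun h => ht (Subgroup.index_eq_one.mp h)
        have hi : 0 < N.index := Nat.pos_of_ne_zero fun h => by rw [h] at h1; omega
        rw [Group.isSolvable_iff_subgroup_quotient N]
        refine ⟨ih (Nat.card N) ?_ N rfl (N.card_subgroup_dvd_card.trans h),
          ih (Nat.card (H ⧸ N)) ?_ _ rfl (N.card_quotient_dvd_card.trans h)⟩
        · rw [← hn, ← h1]; nlinarith [show 2 ≤ N.index by omega]
        · rw [← hn, ← h1]; change N.index < _; nlinarith
    · rw [not_nontrivial_iff_subsingleton] at hH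
      infer_instance

theorem Group.IsSolvable.exists_normal_comm {G : Type*} [Group G] [Nontrivial G]
    (hG : Group.IsSolvable G) : ∃ A : Subgroup G, A.Normal ∧ A ≠ ⊥ ∧
      ∀ x ∈ A, ∀ y ∈ A, x * y = y * x := by
  classical
  have h := hG.solvable
  obtain ⟨n, hn⟩ : ∃ n, Nat.find h = n + 1 := by
    refine Nat.exists_eq_succ_of_ne_zero fun h0 => ?_
    have := Nat.find_spec h
    rw [h0, derivedSeries_zero] at this
    exact top_ne_bot this
  refine ⟨derivedSeries G n, derivedSeries_normal G n, Nat.find_min h (by omega), ?_⟩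
  intro x hx y hy
  have := Nat.find_spec h
  rw [hn, derivedSeries_succ, Subgroup.commutator_eq_bot_iff_le_centralizer] at this
  exact (Subgroup.mem_centralizer_iff.mp (this hx) y hy).symm

/-- If only scalars commute with a finite group of operators, these operators span the
endomorphism algebra. -/
theorem Representation.span_range_eq_top {G V : Type*} [Group G] [Finite G] [AddCommGroup V]
    [Module ℂ V] [FiniteDimensional ℂ V] (ρ : Representation ℂ G V)
    (hρ : ∀ f : V →ₗ[ℂ] V, (∀ g, ρ g * f = f * ρ g) → ∃ c : ℂ, f = c • 1) :
    Submodule.span ℂ (Set.range ρ) = ⊤ := by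
  have := Fintype.ofFinite G
  rcases subsingleton_or_nontrivial V with hV | hV
  · exact Subsingleton.elim _ _
  have hd : (Module.finrank ℂ V : ℂ) ≠ 0 := Nat.cast_ne_zero.mpr Module.finrank_pos.ne'
  have hG : (Fintype.card G : ℂ) ≠ 0 := Nat.cast_ne_zero.mpr Fintype.card_ne_zero
  have hrank : ∀ (φ : V →ₗ[ℂ] ℂ) (w : V), φ.smulRight w ∈ Submodule.span ℂ (Set.range ρ) := by
    intro φ w
    have havg : ∀ v, (Module.finrank ℂ V : ℂ) • ∑ g, φ (ρ g⁻¹ w) • ρ g v =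
        ((Fintype.card G : ℂ) * φ v) • w := by
      intro v
      obtain ⟨c, hc⟩ := hρ (∑ g, ρ g * φ.smulRight v * ρ g⁻¹) fun h => by
        rw [Finset.mul_sum, Finset.sum_mul]
        refine Fintype.sum_equiv (Equiv.mulLeft h) _ _ fun g => ?_
        rw [Equiv.coe_mulLeft, mul_inv_rev, map_mul ρ h g, map_mul ρ g⁻¹, mul_assoc _ _ (ρ h),
          mul_assoc _ _ (ρ h), ← map_mul ρ h⁻¹, inv_mul_cancel, map_one, mul_one]
        simp only [mul_assoc]
      have htr := congrArg (LinearMap.trace ℂ V) hc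
      have h1 : ∀ g, LinearMap.trace ℂ V (ρ g * φ.smulRight v * ρ g⁻¹) = φ v := by
        intro g
        rw [LinearMap.trace_mul_comm, ← mul_assoc, ← map_mul, inv_mul_cancel, map_one, one_mul]
        simp
      rw [map_sum, Finset.sum_congr rfl fun g _ => h1 g] at htr
      simp at htr
      have h2 := congrArg (fun f => f w) hc
      simp only [LinearMap.sum_apply, Module.End.mul_apply, LinearMap.smulRight_apply,
        map_smul, LinearMap.smul_apply, Module.End.one_apply] at h2
      rw [h2, smul_smul, htr, mul_comm]
    have heq : φ.smulRight w = ∑ g, (((Fintype.card G : ℂ)⁻¹ * Module.finrank ℂ V) *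
        φ (ρ g⁻¹ w)) • ρ g := by
      ext v
      simp only [LinearMap.smulRight_apply, LinearMap.sum_apply, LinearMap.smul_apply, mul_smul]
      rw [← Finset.smul_sum, ← Finset.smul_sum, havg, smul_smul, inv_mul_cancel_left₀ hG]
    rw [heq]
    exact Submodule.sum_mem _ fun g _ =>
      Submodule.smul_mem _ _ (Submodule.subset_span (Set.mem_range_self g))
  rw [eq_top_iff]
  intro f _
  let b := Module.finBasis ℂ V
  have hf : f = ∑ i, (b.coord i).smulRight (f (b i)) := by
    refine b.ext fun j => ?_
    simp [Finsupp.single_apply]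
  rw [hf]
  exact Submodule.sum_mem _ fun i _ => hrank _ _

/-- The action of a group on the characters of a normal subgroup by conjugation. -/
instance Subgroup.mulDistribMulActionDual {G : Type*} [Group G] (A : Subgroup G) [A.Normal] :
    MulDistribMulAction G (A →* ℂˣ) where
  smul g l := l.comp (MulAut.conjNormal g⁻¹ : MulAut A).toMonoidHom
  one_smul l := by
    ext a
    change ((l (MulAut.conjNormal (1 : G)⁻¹ a) : ℂˣ) : ℂ) = _
    simp
  mul_smul g h l := by
    ext a
    change ((l (MulAut.conjNormal (g * h)⁻¹ a) : ℂˣ) : ℂ) =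
      (l (MulAut.conjNormal h⁻¹ (MulAut.conjNormal g⁻¹ a)) : ℂˣ)
    simp
  smul_mul _ _ _ := rfl
  smul_one _ := rfl

theorem Subgroup.smul_dual_apply {G : Type*} [Group G] (A : Subgroup G) [A.Normal] (g : G)
    (l : A →* ℂˣ) (a : A) : (g • l) a = l (MulAut.conjNormal g⁻¹ a) := rfl

/-- The projection onto the isotypic component of a character of a finite subgroup. -/
noncomputable def Representation.isotypicProj {G V : Type*} [Group G] [Finite G] [AddCommGroup V]
    [Module ℂ V] (ρ : Representation ℂ G V) (A : Subgroup G) (l : A →* ℂˣ) : V →ₗ[ℂ] V :=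
  (Nat.card A : ℂ)⁻¹ • ∑ᶠ a : A, ((l a⁻¹ : ℂˣ) : ℂ) • ρ a

section Isotypic

variable {G V : Type*} [Group G] [Finite G] [AddCommGroup V] [Module ℂ V]
  (ρ : Representation ℂ G V) (A : Subgroup G)

theorem Representation.isotypicProj_eq [Fintype A] (l : A →* ℂˣ) :
    ρ.isotypicProj A l = (Nat.card A : ℂ)⁻¹ • ∑ a : A, ((l a⁻¹ : ℂˣ) : ℂ) • ρ a := by
  rw [isotypicProj, finsum_eq_sum_of_fintype]

theorem Representation.mul_isotypicProj (l : A →* ℂˣ) (b : A) :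
    ρ b * ρ.isotypicProj A l = ((l b : ℂˣ) : ℂ) • ρ.isotypicProj A l := by
  have := Fintype.ofFinite A
  have h : ∑ a : A, ρ b * (((l a⁻¹ : ℂˣ) : ℂ) • ρ a) =
      ∑ a : A, ((l b : ℂˣ) : ℂ) • (((l a⁻¹ : ℂˣ) : ℂ) • ρ a) := by
    refine Fintype.sum_equiv (Equiv.mulLeft b) _ _ fun a => ?_
    have hb : ((l b : ℂˣ) : ℂ) ≠ 0 := Units.ne_zero _
    simp only [Equiv.coe_mulLeft, mul_inv_rev, map_mul, Units.val_mul, smul_smul, mul_smul_comm,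
      Subgroup.coe_mul]
    congr 1
    simp only [map_inv, Units.val_inv_eq_inv_val]
    field_simp
  rw [isotypicProj_eq, mul_smul_comm, smul_comm, Finset.mul_sum, h, ← Finset.smul_sum]

theorem Representation.isotypicProj_mul_self (l : A →* ℂˣ) :
    ρ.isotypicProj A l * ρ.isotypicProj A l = ρ.isotypicProj A l := by
  have := Fintype.ofFinite A
  conv_lhs => enter [1]; rw [isotypicProj_eq]
  rw [smul_mul_assoc, Finset.sum_mul]
  simp only [smul_mul_assoc, mul_isotypicProj, smul_smul]
  simp [← Nat.cast_smul_eq_nsmul ℂ, smul_smul]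

theorem Representation.isotypicProj_mul_of_ne {l m : A →* ℂˣ} (h : l ≠ m) :
    ρ.isotypicProj A l * ρ.isotypicProj A m = 0 := by
  classical
  have := Fintype.ofFinite A
  conv_lhs => enter [1]; rw [isotypicProj_eq]
  rw [smul_mul_assoc, Finset.sum_mul]
  simp only [smul_mul_assoc, mul_isotypicProj, smul_smul]
  rw [← Finset.sum_smul]
  have h0 := sum_hom_units_eq_zero ((Units.coeHom ℂ).comp (m / l)) fun h1 => h (by
    ext a
    have := congrArg (fun f => f a) h1
    simp only [MonoidHom.comp_apply, MonoidHom.div_apply, Units.coeHom_apply, MonoidHom.one_apply,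
      Units.val_eq_one, div_eq_one] at this
    rw [this])
  have h1 : ∀ a : A, ((l a⁻¹ : ℂˣ) : ℂ) * ((m a : ℂˣ) : ℂ) = ((Units.coeHom ℂ).comp (m / l)) a := by
    intro a
    simp [div_eq_mul_inv, mul_comm]
  simp only [h1, h0, zero_smul, smul_zero]

theorem Representation.conj_isotypicProj [A.Normal] (l : A →* ℂˣ) (g : G) :
    ρ g * ρ.isotypicProj A l = ρ.isotypicProj A (g • l) * ρ g := by
  have := Fintype.ofFinite A
  rw [isotypicProj_eq, isotypicProj_eq, mul_smul_comm, smul_mul_assoc, Finset.mul_sum,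
    Finset.sum_mul]
  congr 1
  refine Fintype.sum_equiv (MulAut.conjNormal g : MulAut A).toEquiv _ _ fun a => ?_
  rw [mul_smul_comm, smul_mul_assoc, Subgroup.smul_dual_apply, ← map_mul]
  congr 1
  · simp
  · rw [← map_mul]
    simp [MulAut.conjNormal_apply]

theorem Representation.sum_isotypicProj (hA : ∀ x ∈ A, ∀ y ∈ A, x * y = y * x)
    [Fintype (A →* ℂˣ)] : ∑ l : A →* ℂˣ, ρ.isotypicProj A l = 1 := by
  classical
  have := Fintype.ofFinite A
  let _ : CommGroup A := { (inferInstance : Group A) with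
    mul_comm := fun x y => Subtype.ext (hA x x.2 y y.2) }
  simp only [isotypicProj_eq]
  rw [← Finset.smul_sum, Finset.sum_comm]
  simp only [← Finset.sum_smul]
  have h0 : ∀ a : A, ∑ l : A →* ℂˣ, ((l a⁻¹ : ℂˣ) : ℂ) = if a = 1 then (Nat.card A : ℂ) else 0 := by
    intro a
    by_cases ha : a = 1
    · rw [if_pos ha]
      have h := CommGroup.card_monoidHom_of_hasEnoughRootsOfUnity A ℂ
      rw [← h, Nat.card_eq_fintype_card]
      simp [ha]
    · rw [if_neg ha]
      refine sum_hom_units_eq_zero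
        ((Units.coeHom ℂ).comp (MonoidHom.eval a⁻¹ : (A →* ℂˣ) →* ℂˣ)) fun h1 => ?_
      obtain ⟨l, hl⟩ := CommGroup.exists_apply_ne_one_of_hasEnoughRootsOfUnity A ℂ
        (a := a⁻¹) (inv_ne_one.mpr ha)
      refine hl (Units.ext ?_)
      exact congrArg (fun f => f l) h1
  simp only [h0]
  simp

/-- The number of constituents of the restriction of an irreducible representation to an abelian
normal subgroup divides the degree, and bounds it. -/
theorem Representation.exists_orbit_dual [FiniteDimensional ℂ V] [Nontrivial V]
    (hρ : ∀ f : V →ₗ[ℂ] V, (∀ g, ρ g * f = f * ρ g) → ∃ c : ℂ, f = c • 1) [A.Normal]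
    [Finite (A →* ℂˣ)] (hA : ∀ x ∈ A, ∀ y ∈ A, x * y = y * x) :
    ∃ l : A →* ℂˣ, Nat.card (MulAction.orbit G l) ∣ Module.finrank ℂ V ∧
      Module.finrank ℂ V * Module.finrank ℂ V ≤ A.index * Nat.card (MulAction.orbit G l) := by
  classical
  have := Fintype.ofFinite (A →* ℂˣ)
  have := Fintype.ofFinite (G ⧸ A)
  obtain ⟨l, hl⟩ : ∃ l : A →* ℂˣ, ρ.isotypicProj A l ≠ 0 := by
    by_contra! h
    have := ρ.sum_isotypicProj A hA
    simp [h] at this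
  refine ⟨l, ?_⟩
  have hE : ∑ m : MulAction.orbit G l, ρ.isotypicProj A m = 1 := by
    obtain ⟨c, hc⟩ := hρ (∑ m : MulAction.orbit G l, ρ.isotypicProj A m) fun g => by
      rw [Finset.mul_sum, Finset.sum_mul]
      refine Fintype.sum_equiv (MulAction.toPerm g) _ _ fun m => ?_
      rw [conj_isotypicProj]
      rfl
    have h1 : (∑ m : MulAction.orbit G l, ρ.isotypicProj A m) * ρ.isotypicProj A l =
        ρ.isotypicProj A l := by
      rw [Finset.sum_mul, Finset.sum_eq_single ⟨l, MulAction.mem_orbit_self l⟩,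
        isotypicProj_mul_self]
      · intro m _ hm
        exact ρ.isotypicProj_mul_of_ne A fun h => hm (Subtype.ext h)
      · simp
    rw [hc, smul_mul_assoc, one_mul] at h1
    have h2 : (c - 1) • ρ.isotypicProj A l = 0 := by rw [sub_smul, h1, one_smul, sub_self]
    rw [hc, sub_eq_zero.mp ((smul_eq_zero.mp h2).resolve_right hl), one_smul]
  constructor
  · have htr : ∀ m : MulAction.orbit G l, LinearMap.trace ℂ V (ρ.isotypicProj A m) =
        LinearMap.trace ℂ V (ρ.isotypicProj A l) := by
      rintro ⟨_, g, rfl⟩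
      have h1 : ρ.isotypicProj A (g • l) = ρ g * ρ.isotypicProj A l * ρ g⁻¹ := by
        rw [conj_isotypicProj, mul_assoc, ← map_mul, mul_inv_cancel, map_one, mul_one]
      change LinearMap.trace ℂ V (ρ.isotypicProj A (g • l)) = _
      rw [h1, LinearMap.trace_mul_comm, ← mul_assoc, ← map_mul, inv_mul_cancel, map_one, one_mul]
    have h2 := congrArg (LinearMap.trace ℂ V) hE
    rw [map_sum, Finset.sum_congr rfl fun m _ => htr m,
      (LinearMap.IsIdempotentElem.isProj_range _ (ρ.isotypicProj_mul_self A l)).trace] at h2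
    simp only [Finset.sum_const, Finset.card_univ, nsmul_eq_mul, LinearMap.trace_one] at h2
    rw [Nat.card_eq_fintype_card]
    exact ⟨_, by exact_mod_cast h2.symm⟩
  · let v : (G ⧸ A) × MulAction.orbit G l → (V →ₗ[ℂ] V) :=
      fun p => ρ p.1.out * ρ.isotypicProj A p.2
    have hv : (Set.range v).finrank ℂ = Module.finrank ℂ V * Module.finrank ℂ V := by
      have hspan : Submodule.span ℂ (Set.range v) = ⊤ := by
        rw [eq_top_iff, ← ρ.span_range_eq_top hρ, Submodule.span_le]
        rintro _ ⟨g, rfl⟩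
        obtain ⟨a, ha⟩ := QuotientGroup.mk_out_eq_mul A g
        have h1 : ρ g = ∑ m : MulAction.orbit G l,
            (((m : A →* ℂˣ) a⁻¹ : ℂˣ) : ℂ) • v (g, m) := by
          rw [← mul_one (ρ g), ← hE, Finset.mul_sum]
          refine Finset.sum_congr rfl fun m _ => ?_
          rw [← mul_smul_comm, ← mul_isotypicProj, ← mul_assoc, ha, ← map_mul]
          simp
        rw [h1]
        exact Submodule.sum_mem _ fun m _ =>
          Submodule.smul_mem _ _ (Submodule.subset_span (Set.mem_range_self _))
      rw [Set.finrank, hspan, finrank_top, Module.finrank_linearMap]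
    have := finrank_range_le_card (R := ℂ) v
    rwa [hv, Fintype.card_prod, ← Nat.card_eq_fintype_card, ← Nat.card_eq_fintype_card] at this

end Isotypic

theorem Subgroup.card_closure_insert_le {D : Type*} [CommGroup D] [Finite D]
    (h2 : ∀ x : D, x * x = 1) (x : D) (s : Set D) :
    Nat.card (closure (insert x s)) ≤ 2 * Nat.card (closure s) := by
  have hmem : ∀ y : Bool × closure s, (if y.1 then x else 1) * (y.2 : D) ∈ closure (insert x s) := by
    rintro ⟨b, z⟩
    refine mul_mem ?_ (closure_mono (Set.subset_insert x s) z.2)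
    cases b
    · exact one_mem _
    · exact subset_closure (Set.mem_insert x s)
  have hsurj : Function.Surjective
      (fun y => ⟨_, hmem y⟩ : Bool × closure s → closure (insert x s)) := by
    rintro ⟨y, hy⟩
    have hy' := hy
    rw [Set.insert_eq, closure_union, mem_sup, ← zpowers_eq_closure] at hy'
    obtain ⟨u, hu, z, hz, rfl⟩ := hy'
    obtain ⟨k, rfl⟩ := mem_zpowers_iff.mp hu
    rcases Int.even_or_odd' k with ⟨j, rfl | rfl⟩
    · exact ⟨(false, ⟨z, hz⟩), Subtype.ext (by simp [zpow_mul, pow_two, h2])⟩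
    · exact ⟨(true, ⟨z, hz⟩), Subtype.ext (by simp [zpow_add, zpow_mul, pow_two, h2])⟩
  have := Nat.card_le_card_of_surjective _ hsurj
  rwa [Nat.card_prod, Nat.card_eq_fintype_card (α := Bool), Fintype.card_bool] at this

theorem Subgroup.card_closure_union_le {D : Type*} [CommGroup D] [Finite D]
    (h2 : ∀ x : D, x * x = 1) (s : Set D) (t : Finset D) :
    Nat.card (closure (s ∪ t)) ≤ 2 ^ t.card * Nat.card (closure s) := by
  classical
  induction t using Finset.induction_on with
  | empty => simp
  | insert a t ha ih =>
    rw [Finset.coe_insert, Set.union_insert, Finset.card_insert_of_notMem ha, pow_succ', mul_assoc]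
    exact (card_closure_insert_le h2 a _).trans (Nat.mul_le_mul_left 2 ih)

section Complement

variable {G D : Type*} [Group G] [CommGroup D] [Finite D] [MulDistribMulAction G D]

/-- Outside a large orbit, the remaining nontrivial elements generate an elementary abelian
`2`-group. -/
theorem Subgroup.closure_compl_orbit_eq_top {l : D} {t : Finset D}
    (ht : ∀ x, x ∈ t ↔ x ≠ 1 ∧ x ∉ MulAction.orbit G l) (hl : l ≠ 1)
    (hlarge : Nat.card D < 2 * (Nat.card (MulAction.orbit G l) + 1))
    (hdvd : ¬ (t.card + 1) ∣ Nat.card D) : closure (t : Set D) = ⊤ := by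
  classical
  have hinv : ∀ (g : G), ∀ x ∈ closure (t : Set D), g • x ∈ closure (t : Set D) := by
    intro g x hx
    induction hx using closure_induction with
    | mem x hx =>
      refine subset_closure ?_
      rw [Finset.mem_coe, ht] at hx ⊢
      refine ⟨fun h => hx.1 ?_, fun h => hx.2 ?_⟩
      · rw [← inv_smul_smul g x, h, smul_one]
      · obtain ⟨k, hk⟩ := h
        exact ⟨g⁻¹ * k, by rw [← inv_smul_smul g x, ← hk]; exact mul_smul _ _ _⟩
    | one => rw [smul_one]; exact one_mem _
    | mul x y _ _ hx hy => rw [smul_mul']; exact mul_mem hx hy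
    | inv x _ hx => rw [smul_inv']; exact inv_mem hx
  by_cases hO : l ∈ closure (t : Set D)
  · have hsub : insert 1 (MulAction.orbit G l) ⊆ (closure (t : Set D) : Set D) := by
      rw [Set.insert_subset_iff]
      refine ⟨one_mem _, ?_⟩
      rintro _ ⟨g, rfl⟩
      exact hinv g l hO
    have h1 : (1 : D) ∉ MulAction.orbit G l := by
      rintro ⟨g, hg⟩
      exact hl (by rw [← inv_smul_smul g l, show g • l = 1 from hg, smul_one])
    have hle := Set.ncard_le_ncard hsub (Set.toFinite _)
    rw [Set.ncard_insert_of_notMem h1 (Set.toFinite _), ← Nat.card_coe_set_eq,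
      ← Nat.card_coe_set_eq] at hle
    obtain ⟨c, hc⟩ := card_subgroup_dvd_card (closure (t : Set D))
    change _ ≤ Nat.card (closure (t : Set D)) at hle
    have hpos : 0 < Nat.card D := Nat.card_pos
    refine eq_top_of_card_eq _ ?_
    have : c < 2 := by nlinarith
    interval_cases c
    · omega
    · omega
  · exfalso
    refine hdvd ?_
    have h1 : (1 : D) ∉ t := fun h => ((ht 1).mp h).1 rfl
    have heq : (closure (t : Set D) : Set D) = insert 1 (t : Set D) := by
      refine Set.Subset.antisymm (fun x hx => ?_)
        (Set.insert_subset (one_mem _) subset_closure)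
      by_contra hx'
      rw [Set.mem_insert_iff, Finset.mem_coe, ht] at hx'
      push Not at hx'
      obtain ⟨g, rfl⟩ := hx'.2 hx'.1
      refine hO ?_
      rw [← inv_smul_smul g l]
      exact hinv _ _ hx
    have hcard : Nat.card (closure (t : Set D)) = t.card + 1 := by
      change Nat.card ((closure (t : Set D) : Set D) : Type _) = _
      rw [heq, Nat.card_coe_set_eq, Set.ncard_insert_of_notMem (by simpa using h1),
        Set.ncard_coe_finset]
    rw [← hcard]
    exact card_subgroup_dvd_card _

/-- The fixed points of an involution acting on an elementary abelian `2`-group. -/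
theorem exists_fixed_subgroup (h2 : ∀ x : D, x * x = 1) (g : G) (hg : ∀ x : D, g • g • x = x) :
    ∃ C : Subgroup D, (∀ x, x ∈ C ↔ g • x = x) ∧ Nat.card D ≤ Nat.card C * Nat.card C := by
  let f : D →* D := MonoidHom.id D * MulDistribMulAction.toMonoidHom D g
  have hf : ∀ x, f x = x * g • x := fun x => rfl
  have hker : ∀ x, x ∈ f.ker ↔ g • x = x := by
    intro x
    rw [MonoidHom.mem_ker, hf, mul_eq_one_iff_inv_eq, inv_eq_of_mul_eq_one_left (h2 x), eq_comm]
  refine ⟨f.ker, hker, ?_⟩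
  have hle : f.range ≤ f.ker := by
    rintro _ ⟨x, rfl⟩
    rw [hker, hf, smul_mul', hg, mul_comm]
  rw [← Subgroup.card_mul_index f.ker, Subgroup.index_ker]
  exact Nat.mul_le_mul_left _ (Subgroup.card_le_of_le hle)

theorem exists_finset_compl_orbit (l : D) (hl : l ≠ 1) :
    ∃ t : Finset D, (∀ x, x ∈ t ↔ x ≠ 1 ∧ x ∉ MulAction.orbit G l) ∧
      t.card + 1 + Nat.card (MulAction.orbit G l) = Nat.card D := by
  classical
  have := Fintype.ofFinite D
  have h1 : (1 : D) ∉ MulAction.orbit G l := by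
    rintro ⟨g, hg⟩
    exact hl (by rw [← inv_smul_smul g l, show g • l = 1 from hg, smul_one])
  refine ⟨(insert 1 (MulAction.orbit G l).toFinset)ᶜ, fun x => by simp, ?_⟩
  have h2 := Finset.card_compl_add_card (insert 1 (MulAction.orbit G l).toFinset)
  rw [Finset.card_insert_of_notMem (by simpa using h1), Set.toFinset_card,
    ← Nat.card_eq_fintype_card, ← Nat.card_eq_fintype_card] at h2
  omega

theorem card_orbit_ne_of_card_eq_thirty_two (h2 : ∀ x : D, x * x = 1) (hD : Nat.card D = 32)
    (l : D) (hl : l ≠ 1) : Nat.card (MulAction.orbit G l) ≠ 27 := by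
  intro hO
  obtain ⟨t, ht, hcard⟩ := exists_finset_compl_orbit (G := G) l hl
  have ht4 : t.card = 4 := by omega
  have htop := Subgroup.closure_compl_orbit_eq_top ht hl (by omega) (by rw [ht4, hD]; norm_num)
  have hle := Subgroup.card_closure_union_le h2 ∅ t
  rw [Set.empty_union, htop, Subgroup.card_top, hD, ht4, Subgroup.closure_empty,
    Subgroup.card_bot] at hle
  omega

theorem exists_fixed_of_card_eq_sixty_four (h2 : ∀ x : D, x * x = 1) (hD : Nat.card D = 64)
    (l : D) (hl : l ≠ 1) (hO : Nat.card (MulAction.orbit G l) = 54) (g : G)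
    (hg : ∀ x : D, g • g • x = x) : ∃ x ∈ MulAction.orbit G l, g • x = x := by
  classical
  have := Fintype.ofFinite D
  by_contra! hfix
  obtain ⟨t, ht, hcard⟩ := exists_finset_compl_orbit (G := G) l hl
  have ht9 : t.card = 9 := by omega
  have htop := Subgroup.closure_compl_orbit_eq_top ht hl (by omega) (by rw [ht9, hD]; norm_num)
  obtain ⟨C, hC, hC64⟩ := exists_fixed_subgroup h2 g hg
  have h1 : (1 : D) ∉ t := fun h => ((ht 1).mp h).1 rfl
  have hsub : (C : Set D).toFinset ⊆ insert 1 t := by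
    intro x hx
    rw [Finset.mem_insert, ht]
    by_cases hx1 : x = 1
    · exact Or.inl hx1
    · exact Or.inr ⟨hx1, fun h => hfix x h ((hC x).mp (by simpa using hx))⟩
  have hCc : (C : Set D).toFinset.card = Nat.card C := by
    rw [Set.toFinset_card, ← Nat.card_eq_fintype_card]
    rfl
  have hle := Finset.card_le_card hsub
  have hdiff := Finset.card_sdiff_add_card_eq_card hsub
  rw [hCc, Finset.card_insert_of_notMem h1, ht9] at hle hdiff
  have hC8 : Nat.card C = 8 := by
    have hdvd := C.card_subgroup_dvd_card
    rw [hD] at hdvd hC64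
    have : 8 ≤ Nat.card C := by nlinarith
    interval_cases Nat.card C <;> omega
  have hgen := Subgroup.card_closure_union_le h2 (C : Set D) (insert 1 t \ (C : Set D).toFinset)
  have htop' : Subgroup.closure ((C : Set D) ∪ ↑(insert 1 t \ (C : Set D).toFinset)) = ⊤ := by
    rw [eq_top_iff, ← htop]
    refine Subgroup.closure_mono fun x hx => ?_
    by_cases hxC : x ∈ C
    · exact Or.inl hxC
    · refine Or.inr ?_
      simp only [Finset.coe_sdiff, Finset.coe_insert, Set.coe_toFinset]
      exact ⟨Or.inr hx, hxC⟩
  rw [htop', Subgroup.card_top, hD, Subgroup.closure_eq, hC8,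
    show (insert 1 t \ (C : Set D).toFinset).card = 2 by omega] at hgen
  omega

end Complement

theorem orbit_arithmetic {a i k : ℕ} (hai : a * i = 3456) (ha : k + 1 ≤ a) (hk : k ∣ 54)
    (h : 54 * 54 ≤ i * k) : a = 32 ∧ k = 27 ∨ a = 64 ∧ k = 54 := by
  have hmul : 2916 * a ≤ 3456 * k := by
    calc 2916 * a = a * (54 * 54) := by ring
      _ ≤ a * (i * k) := Nat.mul_le_mul_left a h
      _ = 3456 * k := by rw [← hai]; ring
  have hdvd : a ∣ 3456 := ⟨i, hai.symm⟩
  have hk' : k ∈ Nat.divisors 54 := Nat.mem_divisors.mpr ⟨hk, by norm_num⟩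
  rw [show Nat.divisors 54 = {1, 2, 3, 6, 9, 18, 27, 54} by decide] at hk'
  simp only [Finset.mem_insert, Finset.mem_singleton] at hk'
  have ha64 : a ≤ 64 := by omega
  rcases hk' with rfl | rfl | rfl | rfl | rfl | rfl | rfl | rfl <;> interval_cases a <;> omega

section Dual

variable {G : Type*} [Group G] [Finite G] (A : Subgroup G)

theorem Subgroup.card_dual (hA : ∀ x ∈ A, ∀ y ∈ A, x * y = y * x) :
    Nat.card (A →* ℂˣ) = Nat.card A := by
  let _ : CommGroup A := { (inferInstance : Group A) with
    mul_comm := fun x y => Subtype.ext (hA x x.2 y y.2) }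
  exact CommGroup.card_monoidHom_of_hasEnoughRootsOfUnity A ℂ

theorem Subgroup.finite_dual (hA : ∀ x ∈ A, ∀ y ∈ A, x * y = y * x) : Finite (A →* ℂˣ) := by
  refine Nat.finite_of_card_ne_zero ?_
  rw [A.card_dual hA]
  exact Nat.card_pos.ne'

variable {V : Type*} [AddCommGroup V] [Module ℂ V] [FiniteDimensional ℂ V] [Nontrivial V]
  (ρ : Representation ℂ G V)

theorem Representation.exists_orbit_dual_of_finrank
    (hρ : ∀ f : V →ₗ[ℂ] V, (∀ g, ρ g * f = f * ρ g) → ∃ c : ℂ, f = c • 1)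
    (hV : Module.finrank ℂ V = 54) (hG : Nat.card G = 3456) [A.Normal]
    (hA : ∀ x ∈ A, ∀ y ∈ A, x * y = y * x) (hbot : A ≠ ⊥) :
    ∃ l : A →* ℂˣ, l ≠ 1 ∧ (Nat.card A = 32 ∧ Nat.card (MulAction.orbit G l) = 27 ∨
      Nat.card A = 64 ∧ Nat.card (MulAction.orbit G l) = 54) := by
  have := A.finite_dual hA
  obtain ⟨l, hdvd, hle⟩ := ρ.exists_orbit_dual A hρ hA
  rw [hV] at hdvd hle
  have hAG := A.card_mul_index
  rw [hG] at hAG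
  have hl : l ≠ 1 := by
    rintro rfl
    have h1 : MulAction.orbit G (1 : A →* ℂˣ) = {1} := by
      ext x
      simp only [MulAction.mem_orbit_iff, Set.mem_singleton_iff]
      have h1 : ∀ g : G, g • (1 : A →* ℂˣ) = 1 := fun g => rfl
      exact ⟨fun ⟨g, hg⟩ => by rw [← hg, h1], fun h => ⟨1, by rw [h, h1]⟩⟩
    rw [h1, Nat.card_unique, mul_one] at hle
    have : 1 < Nat.card A := A.one_lt_card_iff_ne_bot.mpr hbot
    nlinarith
  refine ⟨l, hl, orbit_arithmetic hAG ?_ hdvd hle⟩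
  obtain ⟨t, -, ht⟩ := exists_finset_compl_orbit (G := G) l hl
  rw [← A.card_dual hA]
  omega

theorem Representation.finrank_ne_of_exponent_two
    (hρ : ∀ f : V →ₗ[ℂ] V, (∀ g, ρ g * f = f * ρ g) → ∃ c : ℂ, f = c • 1)
    (hG : Nat.card G = 3456) [A.Normal] (hA : ∀ x ∈ A, x * x = 1) (hbot : A ≠ ⊥) :
    Module.finrank ℂ V ≠ 54 := by
  intro hV
  have hcomm : ∀ x ∈ A, ∀ y ∈ A, x * y = y * x := by
    intro x hx y hy
    rw [eq_inv_of_mul_eq_one_left (hA _ (mul_mem hx hy)), mul_inv_rev,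
      inv_eq_of_mul_eq_one_left (hA x hx), inv_eq_of_mul_eq_one_left (hA y hy)]
  have := A.finite_dual hcomm
  have h2 : ∀ l : A →* ℂˣ, l * l = 1 := by
    intro l
    ext a
    rw [MonoidHom.mul_apply, ← map_mul, Subtype.ext (hA a a.2) (a1 := a * a) (a2 := 1), map_one,
      MonoidHom.one_apply]
  have htriv : ∀ x ∈ A, ∀ l : A →* ℂˣ, x • l = l := by
    intro x hx l
    ext a
    rw [Subgroup.smul_dual_apply]
    congr 2
    refine Subtype.ext ?_
    rw [MulAut.conjNormal_apply, hcomm _ (inv_mem hx) _ a.2]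
    simp
  obtain ⟨l, hl, h | h⟩ := ρ.exists_orbit_dual_of_finrank A hρ hV hG hcomm hbot
  · exact card_orbit_ne_of_card_eq_thirty_two h2 ((A.card_dual hcomm).trans h.1) l hl h.2
  · have : Fact (Nat.Prime 2) := ⟨Nat.prime_two⟩
    obtain ⟨P, hP⟩ := IsPGroup.exists_le_sylow
      (IsPGroup.iff_card.mpr ⟨6, h.1⟩ : IsPGroup 2 A)
    have hPc : Nat.card P = 128 := by
      rw [P.card_eq_multiplicity, hG, show 3456 = 2 ^ 7 * 27 by norm_num,
        Nat.factorization_mul (by norm_num) (by norm_num), Nat.prime_two.factorization_pow,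
        Finsupp.add_apply, Nat.factorization_eq_zero_of_not_dvd (n := 27) (p := 2) (by norm_num)]
      simp
    have hidx : (A.subgroupOf P).index = 2 := by
      have h1 := (A.subgroupOf P).card_mul_index
      rw [Nat.card_congr (Subgroup.subgroupOfEquivOfLe hP).toEquiv, h.1, hPc] at h1
      omega
    obtain ⟨s, hs⟩ : ∃ s : P, s ∉ A.subgroupOf P := by
      by_contra! hcon
      rw [Subgroup.index_eq_one.mpr ((Subgroup.eq_top_iff' _).mpr hcon)] at hidx
      omega
    have hss : (s : G) * s ∈ A := Subgroup.mul_self_mem_of_index_two hidx s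
    obtain ⟨m, hm, hsm⟩ := exists_fixed_of_card_eq_sixty_four h2 ((A.card_dual hcomm).trans h.1)
      l hl h.2 (s : G) fun x => by rw [← mul_smul]; exact htriv _ hss x
    have hstab : A = MulAction.stabilizer G m := by
      refine Subgroup.eq_of_le_of_card_ge (fun x hx => htriv x hx m) ?_
      have h1 := (MulAction.stabilizer G m).card_mul_index
      rw [MulAction.index_stabilizer, MulAction.orbit_eq_iff.mpr hm, ← Nat.card_coe_set_eq, h.2,
        hG] at h1
      omega
    exact hs (by rw [Subgroup.mem_subgroupOf, hstab]; exact hsm)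

end Dual

/-- Schur's lemma in terms of linear maps. -/
theorem FDRep.exists_eq_smul_one {G : Type} [Group G] (V : FDRep ℂ G) [Simple V]
    (f : V →ₗ[ℂ] V) (hf : ∀ g, V.ρ g * f = f * V.ρ g) : ∃ c : ℂ, f = c • 1 := by
  let F : V ⟶ V := ⟨InducedCategory.homMk (ModuleCat.ofHom f), fun g => by
    ext x
    exact (congrArg (fun h => h x) (hf g)).symm⟩
  obtain ⟨c, hc⟩ := endomorphism_simple_eq_smul_id ℂ F
  refine ⟨c, ?_⟩
  ext x
  have h1 : F.hom.hom.hom x = (c • 𝟙 V : V ⟶ V).hom.hom.hom x := by rw [hc]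
  exact h1

/-- There is no finite group of order 3456 with an irreducible complex character
of degree 54. -/
theorem no_group_order_3456_degree_54 (G : Type) [Group G] [Finite G]
    (hcard : Nat.card G = 3456)
    (χ : G → ℂ) (hχ : IsIrrChar G χ) (hdeg : χ 1 = (54 : ℂ)) :
    False := by
  obtain ⟨V, hV, rfl⟩ := hχ
  have hfin : Module.finrank ℂ V = 54 := by
    rw [FDRep.char_one] at hdeg
    exact_mod_cast hdeg
  have hschur := fun f hf => FDRep.exists_eq_smul_one V f hf
  have : Nontrivial V := Module.nontrivial_of_finrank_pos (R := ℂ) (by omega)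
  have : Nontrivial G := Finite.one_lt_card_iff_nontrivial.mp (by omega)
  obtain ⟨A, hAn, hbot, hA⟩ := Group.IsSolvable.exists_normal_comm
    (Group.isSolvable_of_card_dvd 7 3 _ G rfl (by rw [hcard]; norm_num))
  have heven : 2 ∣ Nat.card A := by
    obtain ⟨l, -, h | h⟩ := Representation.exists_orbit_dual_of_finrank A V.ρ hschur hfin hcard hA
      hbot
    · rw [h.1]; norm_num
    · rw [h.1]; norm_num
  have : Fact (Nat.Prime 2) := ⟨Nat.prime_two⟩
  obtain ⟨z, hz⟩ := exists_prime_orderOf_dvd_card' 2 heven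
  let B : Subgroup G :=
    { carrier := {x | x ∈ A ∧ x * x = 1}
      one_mem' := ⟨one_mem _, mul_one _⟩
      mul_mem' := by
        rintro x y ⟨hx, hx2⟩ ⟨hy, hy2⟩
        refine ⟨mul_mem hx hy, ?_⟩
        rw [mul_assoc, ← mul_assoc y x y, hA y hy x hx, mul_assoc x y y, hy2, mul_one, hx2]
      inv_mem' := by
        rintro x ⟨hx, hx2⟩
        exact ⟨inv_mem hx, by rw [← mul_inv_rev, hx2, inv_one]⟩ }
  have hBn : B.Normal := ⟨by
    rintro x ⟨hx, hx2⟩ g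
    refine ⟨hAn.conj_mem x hx g, ?_⟩
    rw [conj_mul, hx2, mul_one, mul_inv_cancel]⟩
  have hzB : (z : G) ∈ B := by
    refine ⟨z.2, ?_⟩
    have h1 := pow_orderOf_eq_one z
    rw [hz, pow_two] at h1
    exact congrArg Subtype.val h1
  have hBbot : B ≠ ⊥ := by
    intro h1
    rw [h1, Subgroup.mem_bot, OneMemClass.coe_eq_one] at hzB
    rw [hzB, orderOf_one] at hz
    omega
  exact Representation.finrank_ne_of_exponent_two B V.ρ hschur hcard (fun x hx => hx.2) hBbot hfin
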